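/- Let $|\cdot|$ be the Euclidean norm on $\mathbb{R}^n$, let $Q(z,r)$ denote the (axis-parallel) cube centered at $z$ with side length $r>0$, and let $\|A\|$ be the operator norm of a matrix with respect to $|\cdot|$. Let $m>1$, let $A_1,\dots,A_m$ be $n\times n$ invertible real matrices with $A_i-A_j$ invertible for $i\neq j$, let $0\le\alpha<n$, and let $$T_\alpha f(x)=\int_{\mathbb{R}^n} |x-A_1y|^{-\alpha_1}\cdots|x-A_my|^{-\alpha_m} f(y)\,dy,$$ where $\alpha_1,\dots,\alpha_m>0$ and $\alpha_1+\cdots+\alpha_m=n-\alpha$. Let $p:\mathbb{R}^n\to(0,\infty)$ be measurable and satisfy, for some constants $c, C_\infty>0$ and $p_\infty$, the conditions $|p(x)-p(y)|\le c/(-\log|x-y|)$ for $|x-y|<1/2$ and $|p(x)-p_\infty|\le C_\infty/\log(e+|x|)$ for all $x$. With $p_-=\inf p$, $p_+=\sup p$ suppose $0<p_-\le p_+<n/\alpha$ (where $n/\alpha=\infty$ if $\alpha=0$), let $\max(1,p_+)<p_0<n/\alpha$, and let $d\ge \min\{\ell\in\mathbb{N}\cup\{0\}: p_-(n+\ell+1)>n\}$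 be an integer. Put $\|f\|_{p(\cdot)}=\inf\{\lambda>0:\int|f(x)/\lambda|^{p(x)}dx\le1\}$. A $(p(\cdot),p_0,d)$-atom supported in a cube $Q$ is a measurable function $a$ vanishing outside $Q$ with $\|a\|_{L^{p_0}}\le |Q|^{1/p_0}/\|\chi_Q\|_{p(\cdot)}$ and $\int a(x)x^\beta dx=0$ for all multi-indices $|\beta|\le d$. For $0\le\beta<n$ let $M_\beta f(x)=\sup_{Q'\ni x}|Q'|^{\beta/n-1}\int_{Q'}|f|$, the supremum being over all cubes $Q'$ containing $x$. Set $D=\max_i\|A_i\|$ and let $\kappa>\sqrt n/2$ (for $n\le 15$ one may take $\kappa=2$). Then there is a constant $C>0$, independent of the atom, such that for every $(p(\cdot),p_0,d)$-atom $a$ supported in a cube $Q=Q(z,r)$, every index $k$ and every $x$ with $|x-A_iz|\ge \kappa Dr$ for all $i$ and $|x-A_kz|\le|x-A_iz|$ for all $i$, the integral defining $T_\alpha a(x)$ converges absolutely and $$|T_\alpha a(x)|\le \frac{C}{\|\chi_Q\|_{p(\cdot)}}\Bigl(M_{\frac{\alpha n}{n+d+1}}(\chi_Q)(A_k^{-1}x)\Bigr)^{\frac{n+d+1}{n}}.$$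 -/

import Mathlib

open MeasureTheory
open scoped ENNReal

noncomputable section

/-- `ℝⁿ` with the Euclidean norm. -/
abbrev Rn (n : ℕ) := EuclideanSpace ℝ (Fin n)

/-- The variable Lebesgue quasinorm
`‖f‖_{p(·)} = inf {l > 0 : ∫ |f(x)/l|^{p(x)} dx ≤ 1}`, with values in `[0,∞]`. -/
def varLpNorm {n : ℕ} (p : Rn n → ℝ) (f : Rn n → ℝ) : ℝ≥0∞ :=
  ⨅ (l : ℝ) (_ : 0 < l) (_ : ∫⁻ x, ENNReal.ofReal (|f x / l| ^ p x) ≤ 1), ENNReal.ofReal l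

/-- The local log-Hölder condition. (For `x = y` the right side is `c / 0 = 0`, as is the left.) -/
def LogHolderLocal {n : ℕ} (p : Rn n → ℝ) : Prop :=
  ∃ c > 0, ∀ x y : Rn n, ‖x - y‖ < 1 / 2 → |p x - p y| ≤ c / (-Real.log ‖x - y‖)

/-- The log-Hölder condition at infinity. -/
def LogHolderInfty {n : ℕ} (p : Rn n → ℝ) : Prop :=
  ∃ C > 0, ∃ pinf : ℝ, ∀ x : Rn n, |p x - pinf| ≤ C / Real.log (Real.exp 1 + ‖x‖)

/-- `p₋ = inf p`. -/
def pMinus {n : ℕ} (p : Rn n → ℝ) : ℝ := ⨅ x, p x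

/-- `p₊ = sup p`; used only for `p` bounded above. -/
def pPlus {n : ℕ} (p : Rn n → ℝ) : ℝ := ⨆ x, p x

/-- `d_{p(·)} = min {l ∈ ℕ ∪ {0} : p₋ (n + l + 1) > n}`. -/
def dIndex {n : ℕ} (p : Rn n → ℝ) : ℕ := sInf {l : ℕ | pMinus p * (n + l + 1) > n}

/-- The (closed) cube centered at `z` with side length `r`. -/
def cube {n : ℕ} (z : Rn n) (r : ℝ) : Set (Rn n) := {x | ∀ i, |x i - z i| ≤ r / 2}

/-- The characteristic function of the cube `Q(z,r)`. -/
def cubeInd {n : ℕ} (z : Rn n) (r : ℝ) : Rn n → ℝ := Set.indicator (cube z r) 1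

/-- The fractional maximal operator
`M_β f(x) = sup_{Q' ∋ x} |Q'|^{β/n - 1} ∫_{Q'} |f|`, with values in `[0,∞]`. -/
def fracMax {n : ℕ} (β : ℝ) (f : Rn n → ℝ) (x : Rn n) : ℝ≥0∞ :=
  ⨆ (z : Rn n) (r : ℝ) (_ : 0 < r) (_ : x ∈ cube z r),
    volume (cube z r) ^ (β / (n : ℝ) - 1) * ∫⁻ y in cube z r, ENNReal.ofReal |f y|

/-- `a` is a `(p(·), p₀, d)`-atom supported in the cube `Q(z,r)`. -/
structure IsPAtom {n : ℕ} (p : Rn n → ℝ) (p₀ : ℝ) (d : ℕ) (a : Rn n → ℝ)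
    (z : Rn n) (r : ℝ) : Prop where
  aestronglyMeasurable : AEStronglyMeasurable a volume
  support : ∀ x, x ∉ cube z r → a x = 0
  size : eLpNorm a (ENNReal.ofReal p₀) volume ≤
    volume (cube z r) ^ (1 / p₀) / varLpNorm p (cubeInd z r)
  moments : ∀ γ : Fin n → ℕ, (∑ i, γ i) ≤ d → ∫ x, a x * ∏ i, x i ^ γ i = 0

/-- The linear map of `ℝⁿ` given by an `n × n` matrix. -/
def mApp {n : ℕ} (A : Matrix (Fin n) (Fin n) ℝ) (x : Rn n) : Rn n :=
  Matrix.toEuclideanLin A x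

/-- The operator norm of a matrix with respect to the Euclidean norm. -/
def opNorm {n : ℕ} (A : Matrix (Fin n) (Fin n) ℝ) : ℝ :=
  ‖Matrix.toEuclideanCLM (𝕜 := ℝ) A‖

/-- `D = max_i ‖A_i‖`. -/
def maxOpNorm {n m : ℕ} (A : Fin m → Matrix (Fin n) (Fin n) ℝ) : ℝ := ⨆ i, opNorm (A i)

/-- The kernel `k(x,y) = |x - A₁ y|^{-α₁} ⋯ |x - A_m y|^{-α_m}`. -/
def kern {n m : ℕ} (A : Fin m → Matrix (Fin n) (Fin n) ℝ) (αe : Fin m → ℝ)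
    (x y : Rn n) : ℝ :=
  ∏ i, ‖x - mApp (A i) y‖ ^ (-(αe i))

/-- The integral operator `T_α f(x) = ∫ k(x,y) f(y) dy`. -/
def Talpha {n m : ℕ} (A : Fin m → Matrix (Fin n) (Fin n) ℝ) (αe : Fin m → ℝ)
    (f : Rn n → ℝ) (x : Rn n) : ℝ :=
  ∫ y, kern A αe x y * f y

end

/-- Taylor's theorem along a segment, with the Taylor polynomial written through the iterated
Fréchet derivatives at the base point. -/
theorem abs_sub_taylor_le {E : Type*} [NormedAddCommGroup E] [NormedSpace ℝ E]
    {f : E → ℝ} {e b : E} {d : ℕ} {C : ℝ}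
    (hf : ∀ t ∈ Set.Icc (0 : ℝ) 1, ContDiffAt ℝ (d + 1 : ℕ) f (e + t • b))
    (hC : ∀ t ∈ Set.Icc (0 : ℝ) 1, ‖iteratedFDeriv ℝ (d + 1) f (e + t • b)‖ ≤ C) :
    |f (e + b) - ∑ j ∈ Finset.range (d + 1),
      ((j.factorial : ℝ)⁻¹ * iteratedFDeriv ℝ j f e (fun _ => b))| ≤ C * ‖b‖ ^ (d + 1) := by
  set h : ℝ → ℝ := fun t => f (e + t • b) with hh
  have hline : ∀ t : ℝ, HasDerivAt (fun t : ℝ => e + t • b) b t := fun t => by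
    simpa using ((hasDerivAt_id t).smul_const b).const_add e
  have hu : UniqueDiffOn ℝ (Set.Icc (0 : ℝ) 1) := uniqueDiffOn_Icc one_pos
  have key : ∀ j ≤ d + 1, ∀ t ∈ Set.Icc (0 : ℝ) 1,
      iteratedDerivWithin j h (Set.Icc 0 1) t = iteratedFDeriv ℝ j f (e + t • b) (fun _ => b) := by
    intro j
    induction j with
    | zero => intro _ t _; simp [hh]
    | succ j ih =>
      intro hj t ht
      rw [iteratedDerivWithin_succ]
      rw [derivWithin_congr (fun s hs => ih (by omega) s hs) (ih (by omega) t ht)]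
      have hd : DifferentiableAt ℝ (iteratedFDeriv ℝ j f) (e + t • b) :=
        (hf t ht).differentiableAt_iteratedFDeriv (by exact_mod_cast hj)
      have h1 := hd.hasFDerivAt.comp_hasDerivAt t (hline t)
      have h2 := ((ContinuousMultilinearMap.apply ℝ (fun _ : Fin j => E) ℝ
        (fun _ => b)).hasFDerivAt.comp_hasDerivAt t h1)
      rw [iteratedFDeriv_succ_apply_left]
      exact h2.hasDerivWithinAt.derivWithin (hu t ht)
  have hcont : ContDiffOn ℝ (d + 1 : ℕ) h (Set.Icc 0 1) := by
    intro t ht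
    refine ((hf t ht).comp t ?_).contDiffWithinAt
    fun_prop
  have hT := taylor_mean_remainder_bound (f := h) (a := 0) (b := 1) (x := 1) (n := d)
    (C := C * ‖b‖ ^ (d + 1)) zero_le_one (by exact_mod_cast hcont) (by simp) (by
      intro t ht
      rw [key _ le_rfl t ht]
      refine (ContinuousMultilinearMap.le_opNorm _ _).trans ?_
      simp only [Finset.prod_const, Finset.card_univ, Fintype.card_fin]
      gcongr
      exact hC t ht)
  have h0 : (0 : ℝ) ≤ C * ‖b‖ ^ (d + 1) :=
    mul_nonneg ((norm_nonneg _).trans (hC 0 (by simp))) (by positivity)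
  have hfac : (1 : ℝ) ≤ d.factorial := by exact_mod_cast d.factorial_pos
  rw [taylor_within_apply, Real.norm_eq_abs] at hT
  have hsum : ∑ j ∈ Finset.range (d + 1), ((j.factorial : ℝ)⁻¹ * (1 - 0) ^ j) •
      iteratedDerivWithin j h (Set.Icc 0 1) 0 = ∑ j ∈ Finset.range (d + 1),
      ((j.factorial : ℝ)⁻¹ * iteratedFDeriv ℝ j f e (fun _ => b)) := by
    refine Finset.sum_congr rfl fun j hj => ?_
    rw [key j (by have := Finset.mem_range.1 hj; omega) 0 (by simp)]
    simp
  rw [hsum] at hT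
  have h1 : h 1 = f (e + b) := by simp [hh]
  rw [h1] at hT
  refine hT.trans ?_
  simp only [sub_zero, one_pow, mul_one]
  exact div_le_self h0 hfac

/-- The function `q ↦ ∏ ‖q i‖ ^ (-α i)` on tuples of vectors. -/
noncomputable def prodNormRpow {n m : ℕ} (αe : Fin m → ℝ) (q : Fin m → Rn n) : ℝ :=
  ∏ i, ‖q i‖ ^ (-(αe i))

theorem contDiffAt_prodNormRpow {n m : ℕ} (αe : Fin m → ℝ) {N : WithTop ℕ∞} {q : Fin m → Rn n}
    (hq : ∀ i, q i ≠ 0) : ContDiffAt ℝ N (prodNormRpow αe) q := by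
  unfold prodNormRpow
  refine contDiffAt_prod fun i _ => ?_
  refine ContDiffAt.rpow_const_of_ne ?_ (norm_ne_zero_iff.2 (hq i))
  exact ContDiffAt.norm ℝ (by fun_prop) (hq i)

theorem exists_norm_iteratedFDeriv_prodNormRpow_le {n m : ℕ} (αe : Fin m → ℝ) (j : ℕ)
    {δ : ℝ} (hδ : 0 < δ) (R : ℝ) :
    ∃ C : ℝ, 0 < C ∧ ∀ q : Fin m → Rn n, (∀ i, δ ≤ ‖q i‖) → (∀ i, ‖q i‖ ≤ R) →
      ‖iteratedFDeriv ℝ j (prodNormRpow αe) q‖ ≤ C := by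
  set K : Set (Fin m → Rn n) := {q | (∀ i, δ ≤ ‖q i‖) ∧ ∀ i, ‖q i‖ ≤ R} with hK
  have hcl : IsClosed K := by
    simp only [hK, Set.ofPred_and, Set.ofPred_forall]
    refine (isClosed_iInter fun i => ?_).inter (isClosed_iInter fun i => ?_)
    · exact isClosed_le (by fun_prop) (by fun_prop)
    · exact isClosed_le (by fun_prop) (by fun_prop)
  have hcomp : IsCompact K := by
    refine (isCompact_closedBall (0 : Fin m → Rn n) (max R 0)).of_isClosed_subset hcl ?_
    intro q hq
    rw [mem_closedBall_zero_iff, pi_norm_le_iff_of_nonneg (le_max_right _ _)]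
    exact fun i => (hq.2 i).trans (le_max_left _ _)
  have hcont : ContinuousOn (iteratedFDeriv ℝ j (prodNormRpow (n := n) αe)) K := by
    intro q hq
    have : ContDiffAt ℝ j (prodNormRpow αe) q :=
      contDiffAt_prodNormRpow αe fun i => norm_pos_iff.1 (hδ.trans_le (hq.1 i))
    exact (this.continuousAt_iteratedFDeriv le_rfl).continuousWithinAt
  obtain ⟨C, hC⟩ := hcomp.exists_bound_of_continuousOn hcont
  exact ⟨max C 1, by positivity, fun q h1 h2 => (hC q ⟨h1, h2⟩).trans (le_max_left _ _)⟩

theorem cube_eq_preimage {n : ℕ} (z : Rn n) {r : ℝ} (hr : 0 ≤ r) :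
    cube z r = (WithLp.ofLp : Rn n → Fin n → ℝ) ⁻¹'
      Metric.closedBall (WithLp.ofLp z) (r / 2) := by
  ext y
  simp [cube, dist_pi_le_iff (div_nonneg hr zero_le_two), Real.dist_eq]

theorem isClosed_cube {n : ℕ} (z : Rn n) (r : ℝ) : IsClosed (cube z r) := by
  simp only [cube, Set.ofPred_forall]
  exact isClosed_iInter fun i => isClosed_le (by fun_prop) (by fun_prop)

theorem volume_cube {n : ℕ} (z : Rn n) {r : ℝ} (hr : 0 ≤ r) :
    volume (cube z r) = ENNReal.ofReal (r ^ n) := by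
  rw [cube_eq_preimage z hr, (PiLp.volume_preserving_ofLp (Fin n)).measure_preimage
    measurableSet_closedBall.nullMeasurableSet, Real.volume_pi_closedBall _ (div_nonneg hr zero_le_two)]
  simp [mul_div_cancel₀]

theorem norm_sub_le_of_mem_cube {n : ℕ} {y z : Rn n} {r : ℝ} (hr : 0 ≤ r) (hy : y ∈ cube z r) :
    ‖y - z‖ ≤ Real.sqrt n * (r / 2) := by
  rw [EuclideanSpace.norm_eq]
  refine Real.sqrt_le_iff.2 ⟨by positivity, ?_⟩
  rw [mul_pow, Real.sq_sqrt (Nat.cast_nonneg n)]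
  calc ∑ i, ‖(y - z) i‖ ^ 2 ≤ ∑ _i : Fin n, (r / 2) ^ 2 := by
        refine Finset.sum_le_sum fun i _ => ?_
        exact pow_le_pow_left₀ (norm_nonneg _) (by simpa using hy i) 2
    _ = _ := by simp

theorem isCompact_cube {n : ℕ} (z : Rn n) {r : ℝ} (hr : 0 ≤ r) : IsCompact (cube z r) :=
  (isCompact_closedBall z (Real.sqrt n * (r / 2))).of_isClosed_subset (isClosed_cube z r)
    fun _ hy => by simpa [dist_eq_norm] using norm_sub_le_of_mem_cube hr hy

theorem integrable_mul_continuous_of_support {n : ℕ} {a g : Rn n → ℝ} {z : Rn n} {r : ℝ}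
    (hr : 0 ≤ r) (ha : Integrable a) (hs : ∀ x, x ∉ cube z r → a x = 0) (hg : Continuous g) :
    Integrable fun x => a x * g x := by
  have h : IntegrableOn (fun x => a x * g x) (cube z r) :=
    ha.integrableOn.mul_continuousOn hg.continuousOn (isCompact_cube z hr)
  refine (integrableOn_iff_integrable_of_support_subset fun x hx => ?_).1 h
  by_contra hxc
  exact hx (by simp [hs x hxc])

/-- Vanishing moments annihilate all polynomials of the corresponding degree. -/
theorem integral_mul_eval_eq_zero {n d : ℕ} {a : Rn n → ℝ} {z : Rn n} {r : ℝ}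
    (hr : 0 ≤ r) (ha : Integrable a) (hs : ∀ x, x ∉ cube z r → a x = 0)
    (hmom : ∀ γ : Fin n → ℕ, (∑ i, γ i) ≤ d → ∫ x, a x * ∏ i, x i ^ γ i = 0)
    {P : MvPolynomial (Fin n) ℝ} (hP : P.totalDegree ≤ d) :
    ∫ x : Rn n, a x * MvPolynomial.eval (fun i => x i) P = 0 := by
  simp only [MvPolynomial.eval_eq', Finset.mul_sum]
  rw [integral_finsetSum]
  · refine Finset.sum_eq_zero fun γ hγ => ?_
    have h1 := hmom γ (by
      refine le_trans ?_ ((MvPolynomial.le_totalDegree hγ).trans hP)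
      rw [Finsupp.sum_fintype _ _ (by simp)])
    simp only [mul_left_comm (a _)]
    rw [integral_const_mul, h1, mul_zero]
  · intro γ _
    exact integrable_mul_continuous_of_support hr ha hs (by fun_prop)

/-- A multilinear form evaluated on the diagonal is polynomial in the coordinates. -/
theorem exists_mvPolynomial_eval_eq_multilinear {n j : ℕ}
    (L : MultilinearMap ℝ (fun _ : Fin j => Rn n) ℝ) (z : Rn n) :
    ∃ P : MvPolynomial (Fin n) ℝ, P.totalDegree ≤ j ∧
      ∀ y : Rn n, MvPolynomial.eval (fun i => y i) P = L fun _ => y - z := by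
  refine ⟨∑ f : Fin j → Fin n, MvPolynomial.C (L fun l => EuclideanSpace.single (f l) 1) *
    ∏ l, (MvPolynomial.X (f l) - MvPolynomial.C (z (f l))), ?_, fun y => ?_⟩
  · refine MvPolynomial.totalDegree_finsetSum_le fun f _ => ?_
    refine (MvPolynomial.totalDegree_mul _ _).trans ?_
    rw [MvPolynomial.totalDegree_C, zero_add]
    refine (MvPolynomial.totalDegree_finsetProd _ _).trans ?_
    calc _ ≤ ∑ _l : Fin j, 1 := Finset.sum_le_sum fun l _ =>
          (MvPolynomial.totalDegree_sub_C_le _ _).trans (MvPolynomial.totalDegree_X _).le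
      _ = j := by simp
  · have hy : y - z = ∑ i, (y i - z i) • (EuclideanSpace.single i (1 : ℝ) : Rn n) := by
      have := (EuclideanSpace.basisFun (Fin n) ℝ).sum_repr (y - z)
      simpa using this.symm
    conv_rhs => rw [hy]
    rw [MultilinearMap.map_sum]
    simp only [map_sum, map_mul, map_prod, map_sub, MvPolynomial.eval_C, MvPolynomial.eval_X]
    refine Finset.sum_congr rfl fun f _ => ?_
    rw [L.map_smul_univ, smul_eq_mul, mul_comm]

theorem varLpNorm_cubeInd_ne_zero {n : ℕ} {p : Rn n → ℝ} (hpm : 0 < pMinus p)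
    (z : Rn n) {r : ℝ} (hr : 0 < r) : varLpNorm p (cubeInd z r) ≠ 0 := by
  have hbdd : BddBelow (Set.range p) := by
    by_contra h
    rw [pMinus, Real.iInf_of_not_bddBelow h] at hpm
    exact lt_irrefl _ hpm
  set q := pMinus p
  set c : ℝ := min 1 ((r ^ n) ^ (1 / q)) with hc
  have hcpos : 0 < c := lt_min one_pos (Real.rpow_pos_of_pos (pow_pos hr n) _)
  refine ne_of_gt (lt_of_lt_of_le (ENNReal.ofReal_pos.2 hcpos) ?_)
  refine le_iInf fun l => le_iInf fun hl => le_iInf fun hle_int => ENNReal.ofReal_le_ofReal ?_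
  rcases le_or_gt 1 l with h1 | h1
  · exact (min_le_left _ _).trans h1
  refine (min_le_right _ _).trans ?_
  have hlow : ENNReal.ofReal ((1 / l) ^ q * r ^ n) ≤ 1 := by
    refine le_trans ?_ hle_int
    calc ENNReal.ofReal ((1 / l) ^ q * r ^ n)
        = ENNReal.ofReal ((1 / l) ^ q) * volume (cube z r) := by
          rw [volume_cube z hr.le, ENNReal.ofReal_mul (by positivity)]
      _ = ∫⁻ _x in cube z r, ENNReal.ofReal ((1 / l) ^ q) := by rw [setLIntegral_const]
      _ ≤ ∫⁻ x in cube z r, ENNReal.ofReal (|cubeInd z r x / l| ^ p x) := by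
          refine setLIntegral_mono' (isClosed_cube z r).measurableSet fun x hx => ?_
          refine ENNReal.ofReal_le_ofReal ?_
          have : cubeInd z r x = 1 := by simp [cubeInd, hx]
          rw [this, abs_of_pos (by positivity)]
          exact Real.rpow_le_rpow_of_exponent_le (by rw [le_div_iff₀ hl]; linarith)
            (ciInf_le hbdd x)
      _ ≤ _ := setLIntegral_le_lintegral _ _
  rw [← ENNReal.ofReal_one, ENNReal.ofReal_le_ofReal_iff zero_le_one,
    Real.div_rpow zero_le_one hl.le, Real.one_rpow, one_div, inv_mul_le_one₀
    (Real.rpow_pos_of_pos hl _)] at hlow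
  calc (r ^ n) ^ (1 / q) ≤ (l ^ q) ^ (1 / q) := by gcongr
    _ = l := by rw [← Real.rpow_mul hl.le, mul_one_div_cancel hpm.ne', Real.rpow_one]

theorem IsPAtom.eLpNorm_one_le {n d : ℕ} {p : Rn n → ℝ} {p₀ : ℝ} {a : Rn n → ℝ} {z : Rn n}
    {r : ℝ} (h : IsPAtom p p₀ d a z r) (hr : 0 < r) (hp₀ : 1 ≤ p₀) :
    eLpNorm a 1 volume ≤ ENNReal.ofReal (r ^ n) * (varLpNorm p (cubeInd z r))⁻¹ := by
  have hQ := (isClosed_cube z r).measurableSet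
  have hind : (cube z r).indicator a = a := by
    ext x
    by_cases hx : x ∈ cube z r
    · simp [hx]
    · simp [hx, h.support x hx]
  have hV0 : volume (cube z r) ≠ 0 := by
    rw [volume_cube z hr.le]; simpa using pow_pos hr n
  have hVt : volume (cube z r) ≠ ∞ := by rw [volume_cube z hr.le]; exact ENNReal.ofReal_ne_top
  have hle : (1 : ℝ≥0∞) ≤ ENNReal.ofReal p₀ := by
    rw [← ENNReal.ofReal_one]; exact ENNReal.ofReal_le_ofReal hp₀
  have h1 := eLpNorm_le_eLpNorm_mul_rpow_measure_univ hle
    (h.aestronglyMeasurable.restrict (s := cube z r))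
  rw [← eLpNorm_indicator_eq_eLpNorm_restrict hQ, ← eLpNorm_indicator_eq_eLpNorm_restrict hQ,
    hind, Measure.restrict_apply_univ, ENNReal.toReal_one,
    ENNReal.toReal_ofReal (zero_le_one.trans hp₀)] at h1
  calc eLpNorm a 1 volume ≤ _ := h1
    _ ≤ (volume (cube z r) ^ (1 / p₀) / varLpNorm p (cubeInd z r)) *
          volume (cube z r) ^ (1 / 1 - 1 / p₀) := by gcongr; exact h.size
    _ = (volume (cube z r) ^ (1 / p₀) * volume (cube z r) ^ (1 / 1 - 1 / p₀)) *
          (varLpNorm p (cubeInd z r))⁻¹ := by rw [div_eq_mul_inv]; ring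
    _ = _ := by
        rw [← ENNReal.rpow_add _ _ hV0 hVt, ← volume_cube z hr.le]
        simp

theorem IsPAtom.integrable {n d : ℕ} {p : Rn n → ℝ} {p₀ : ℝ} {a : Rn n → ℝ} {z : Rn n}
    {r : ℝ} (h : IsPAtom p p₀ d a z r) (hr : 0 < r) (hp₀ : 1 ≤ p₀) (hpm : 0 < pMinus p) :
    Integrable a := by
  rw [← memLp_one_iff_integrable]
  refine ⟨h.aestronglyMeasurable, (h.eLpNorm_one_le hr hp₀).trans_lt ?_⟩
  exact ENNReal.mul_lt_top ENNReal.ofReal_lt_top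
    (ENNReal.inv_lt_top.2 (pos_iff_ne_zero.2 (varLpNorm_cubeInd_ne_zero hpm z hr)))

theorem ofReal_le_fracMax_cubeInd {n : ℕ} (β : ℝ) (hn : 0 < n) (z w : Rn n) {r R : ℝ} (hr : 0 < r)
    (hrR : r ≤ R) (hwR : 2 * ‖w - z‖ ≤ R) :
    ENNReal.ofReal (R ^ (β - n) * r ^ n) ≤ fracMax β (cubeInd z r) w := by
  have hR := hr.trans_le hrR
  have hw : w ∈ cube z R := fun i => by
    have := PiLp.norm_apply_le (w - z) i
    simp only [PiLp.sub_apply, Real.norm_eq_abs] at this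
    linarith
  refine le_trans ?_ (le_iSup_of_le z (le_iSup_of_le R (le_iSup_of_le hR (le_iSup_of_le hw le_rfl))))
  have hsub : cube z r ⊆ cube z R := fun y hy i => (hy i).trans (by linarith)
  have hle_int : volume (cube z r) ≤ ∫⁻ y in cube z R, ENNReal.ofReal |cubeInd z r y| := by
    calc volume (cube z r) = ∫⁻ _y in cube z r, 1 := by simp
      _ ≤ ∫⁻ y in cube z r, ENNReal.ofReal |cubeInd z r y| :=
          setLIntegral_mono' (isClosed_cube z r).measurableSet fun y hy => by simp [cubeInd, hy]
      _ ≤ _ := lintegral_mono_set hsub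
  have hpow : volume (cube z R) ^ (β / (n : ℝ) - 1) = ENNReal.ofReal (R ^ (β - n)) := by
    rw [volume_cube z hR.le, ENNReal.ofReal_rpow_of_pos (pow_pos hR n), ← Real.rpow_natCast,
      ← Real.rpow_mul hR.le]
    congr 2
    have : (n : ℝ) ≠ 0 := by positivity
    field_simp
  rw [hpow, ENNReal.ofReal_mul (by positivity), ← volume_cube z hr.le]
  gcongr

theorem mApp_eq_toEuclideanCLM {n : ℕ} (A : Matrix (Fin n) (Fin n) ℝ) (v : Rn n) :
    mApp A v = Matrix.toEuclideanCLM (𝕜 := ℝ) A v := rfl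

theorem continuous_mApp {n : ℕ} (A : Matrix (Fin n) (Fin n) ℝ) : Continuous (mApp A) :=
  (Matrix.toEuclideanCLM (𝕜 := ℝ) A).continuous

theorem mApp_sub {n : ℕ} (A : Matrix (Fin n) (Fin n) ℝ) (v w : Rn n) :
    mApp A (v - w) = mApp A v - mApp A w := map_sub _ _ _

theorem mApp_inv_mApp {n : ℕ} {A : Matrix (Fin n) (Fin n) ℝ} (hA : IsUnit A) (v : Rn n) :
    mApp A⁻¹ (mApp A v) = v := by
  have hdet : IsUnit A.det := (Matrix.isUnit_iff_isUnit_det A).1 hA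
  rw [mApp_eq_toEuclideanCLM, mApp_eq_toEuclideanCLM, ← mul_apply_eq_comp, ← map_mul,
    Matrix.nonsing_inv_mul A hdet, map_one, one_apply_eq_self]

theorem opNorm_le_maxOpNorm {n m : ℕ} (A : Fin m → Matrix (Fin n) (Fin n) ℝ) (i : Fin m) :
    opNorm (A i) ≤ maxOpNorm A := le_ciSup (Set.finite_range fun i => opNorm (A i)).bddAbove i

theorem norm_mApp_le {n m : ℕ} (A : Fin m → Matrix (Fin n) (Fin n) ℝ) (i : Fin m) (v : Rn n) :
    ‖mApp (A i) v‖ ≤ maxOpNorm A * ‖v‖ :=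
  ((Matrix.toEuclideanCLM (𝕜 := ℝ) (A i)).le_opNorm v).trans
    (mul_le_mul_of_nonneg_right (opNorm_le_maxOpNorm A i) (norm_nonneg v))

theorem maxOpNorm_pos {n m : ℕ} (hn : 0 < n) (hm : 0 < m) {A : Fin m → Matrix (Fin n) (Fin n) ℝ}
    (hA : ∀ i, IsUnit (A i)) : 0 < maxOpNorm A := by
  have : Nonempty (Fin n) := ⟨⟨0, hn⟩⟩
  refine lt_of_lt_of_le ?_ (opNorm_le_maxOpNorm A ⟨0, hm⟩)
  refine norm_pos_iff.2 fun h => (hA ⟨0, hm⟩).ne_zero ?_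
  exact (map_eq_zero_iff _ (Matrix.toEuclideanCLM (𝕜 := ℝ) (n := Fin n)).injective).1 h

theorem measurable_kern {n m : ℕ} (A : Fin m → Matrix (Fin n) (Fin n) ℝ) (αe : Fin m → ℝ)
    (x : Rn n) : Measurable (kern A αe x) := by
  unfold kern
  refine Finset.measurable_prod _ fun i _ => ?_
  exact ((continuous_const.sub (continuous_mApp (A i))).norm.measurable).pow_const _

/-- Away from the points `A i z`, the kernel is approximated on the cube `Q(z,r)` by a polynomial
of degree at most `d`, with an error of the order of the Taylor remainder. -/
theorem exists_kern_polynomial_approx {n m : ℕ} (hn : 0 < n) (hm : 0 < m)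
    {A : Fin m → Matrix (Fin n) (Fin n) ℝ} (hA : ∀ i, IsUnit (A i))
    {αe : Fin m → ℝ} (hαe : ∀ i, 0 ≤ αe i) (d : ℕ) {κ : ℝ} (hκ : Real.sqrt n / 2 < κ) :
    ∃ C : ℝ, 0 < C ∧ ∀ (z : Rn n) (r : ℝ), 0 < r → ∀ (x : Rn n) (k : Fin m),
      (∀ i, κ * maxOpNorm A * r ≤ ‖x - mApp (A i) z‖) →
      (∀ i, ‖x - mApp (A k) z‖ ≤ ‖x - mApp (A i) z‖) →
      ∃ P : MvPolynomial (Fin n) ℝ, P.totalDegree ≤ d ∧ ∀ y ∈ cube z r,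
        |kern A αe x y - MvPolynomial.eval (fun i => y i) P| ≤
          C * ‖x - mApp (A k) z‖ ^ (-∑ i, αe i) * (r / ‖x - mApp (A k) z‖) ^ (d + 1) := by
  have hD := maxOpNorm_pos hn hm hA
  set D := maxOpNorm A with hDdef
  have hsn : 0 < Real.sqrt n := Real.sqrt_pos.2 (by exact_mod_cast hn)
  have hκ0 : 0 < κ := (by positivity : (0 : ℝ) < Real.sqrt n / 2).trans hκ
  set θ : ℝ := Real.sqrt n / 2 / κ with hθ
  have hθ1 : θ < 1 := (div_lt_one hκ0).2 hκ
  have hθ0 : 0 < θ := by positivity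
  obtain ⟨C, hC0, hC⟩ := exists_norm_iteratedFDeriv_prodNormRpow_le (n := n) αe (d + 1)
    (sub_pos.2 hθ1) 2
  refine ⟨C * (D * Real.sqrt n / 2) ^ (d + 1), by positivity, ?_⟩
  intro z r hr x k hfar hk
  set s : Fin m → ℝ := fun i => ‖x - mApp (A i) z‖ with hs
  have hs0 : ∀ i, 0 < s i := fun i => lt_of_lt_of_le (by positivity) (hfar i)
  set e : Fin m → Rn n := fun i => (s i)⁻¹ • (x - mApp (A i) z) with he
  set L : Rn n →L[ℝ] (Fin m → Rn n) :=
    ContinuousLinearMap.pi fun i => (-(s i)⁻¹) • Matrix.toEuclideanCLM (𝕜 := ℝ) (A i) with hL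
  have hLapp : ∀ v i, L v i = -((s i)⁻¹ • mApp (A i) v) := fun v i => by
    simp [hL, mApp_eq_toEuclideanCLM]
  have hnormL : ∀ y ∈ cube z r, ∀ i, ‖L (y - z) i‖ ≤ (s i)⁻¹ * (D * (Real.sqrt n * (r / 2))) := by
    intro y hy i
    rw [hLapp, norm_neg, norm_smul, norm_inv, Real.norm_of_nonneg (hs0 i).le]
    have h1 := hs0 i
    gcongr
    exact (norm_mApp_le A i _).trans (by gcongr; exact norm_sub_le_of_mem_cube hr.le hy)
  have hLθ : ∀ y ∈ cube z r, ∀ i, ‖L (y - z) i‖ ≤ θ := by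
    intro y hy i
    refine (hnormL y hy i).trans ?_
    rw [inv_mul_le_iff₀ (hs0 i)]
    calc D * (Real.sqrt n * (r / 2)) = κ * D * r * θ := by rw [hθ]; field_simp
      _ ≤ s i * θ := by gcongr; exact hfar i
  have hLρ : ∀ y ∈ cube z r, ‖L (y - z)‖ ≤ D * Real.sqrt n / 2 * (r / s k) := by
    intro y hy
    have h1 := hs0 k
    rw [pi_norm_le_iff_of_nonneg (by positivity)]
    intro i
    calc _ ≤ _ := hnormL y hy i
      _ ≤ (s k)⁻¹ * (D * (Real.sqrt n * (r / 2))) := by gcongr; exact hk i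
      _ = _ := by field_simp
  have henorm : ∀ i, ‖e i‖ = 1 := fun i => by
    rw [he, norm_smul, norm_inv, Real.norm_of_nonneg (hs0 i).le]
    exact inv_mul_cancel₀ (hs0 i).ne'
  have hseg : ∀ y ∈ cube z r, ∀ t ∈ Set.Icc (0 : ℝ) 1, ∀ i,
      1 - θ ≤ ‖(e + t • L (y - z)) i‖ ∧ ‖(e + t • L (y - z)) i‖ ≤ 2 := by
    intro y hy t ht i
    have h1 : ‖t • L (y - z) i‖ ≤ θ := by
      rw [norm_smul, Real.norm_of_nonneg ht.1]
      exact (mul_le_of_le_one_left (norm_nonneg _) ht.2).trans (hLθ y hy i)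
    have h2 := norm_add_le (e i) (t • L (y - z) i)
    have h3 := norm_sub_norm_le (e i) (-(t • L (y - z) i))
    rw [norm_neg, sub_neg_eq_add] at h3
    rw [henorm] at h2 h3
    constructor <;> simp only [Pi.add_apply, Pi.smul_apply] <;> linarith
  set W : ℝ := ∏ i, s i ^ (-αe i) with hW
  have hW0 : 0 ≤ W := Finset.prod_nonneg fun i _ => Real.rpow_nonneg (hs0 i).le _
  have hkern : ∀ y, kern A αe x y = W * prodNormRpow αe (e + L (y - z)) := by
    intro y
    rw [hW, kern, prodNormRpow, ← Finset.prod_mul_distrib]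
    refine Finset.prod_congr rfl fun i _ => ?_
    have h1 : (e + L (y - z)) i = (s i)⁻¹ • (x - mApp (A i) y) := by
      rw [Pi.add_apply, hLapp, he, mApp_sub, ← smul_neg, ← smul_add]
      congr 1
      abel
    rw [h1, norm_smul, norm_inv, Real.norm_of_nonneg (hs0 i).le,
      ← Real.mul_rpow (hs0 i).le (by have := hs0 i; positivity), mul_inv_cancel_left₀ (hs0 i).ne']
  choose P hPdeg hPeval using fun j : ℕ => exists_mvPolynomial_eval_eq_multilinear
    ((iteratedFDeriv ℝ j (prodNormRpow αe) e).toMultilinearMap.compLinearMap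
      fun _ => (L : Rn n →ₗ[ℝ] Fin m → Rn n)) z
  refine ⟨∑ j ∈ Finset.range (d + 1), MvPolynomial.C (W * (j.factorial : ℝ)⁻¹) * P j, ?_, ?_⟩
  · refine MvPolynomial.totalDegree_finsetSum_le fun j hj => ?_
    refine (MvPolynomial.totalDegree_mul _ _).trans ?_
    rw [MvPolynomial.totalDegree_C, zero_add]
    exact (hPdeg j).trans (Nat.lt_succ_iff.1 (Finset.mem_range.1 hj))
  intro y hy
  have hT := abs_sub_taylor_le (f := prodNormRpow αe) (e := e) (b := L (y - z)) (d := d) (C := C)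
    (fun t ht => contDiffAt_prodNormRpow αe fun i =>
      norm_pos_iff.1 ((sub_pos.2 hθ1).trans_le (hseg y hy t ht i).1))
    (fun t ht => hC _ (fun i => (hseg y hy t ht i).1) fun i => (hseg y hy t ht i).2)
  have heval : MvPolynomial.eval (fun i => y i)
      (∑ j ∈ Finset.range (d + 1), MvPolynomial.C (W * (j.factorial : ℝ)⁻¹) * P j) =
      W * ∑ j ∈ Finset.range (d + 1), ((j.factorial : ℝ)⁻¹ *
        iteratedFDeriv ℝ j (prodNormRpow αe) e (fun _ => L (y - z))) := by
    rw [map_sum, Finset.mul_sum]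
    refine Finset.sum_congr rfl fun j _ => ?_
    rw [map_mul, MvPolynomial.eval_C, hPeval, mul_assoc]
    rfl
  have hWle : W ≤ s k ^ (-∑ i, αe i) := by
    rw [← Finset.sum_neg_distrib, Real.rpow_sum_of_pos (hs0 k)]
    refine Finset.prod_le_prod (fun i _ => Real.rpow_nonneg (hs0 i).le _) fun i _ => ?_
    exact Real.rpow_le_rpow_of_nonpos (hs0 k) (hk i) (neg_nonpos.2 (hαe i))
  rw [heval, hkern, ← mul_sub, abs_mul, abs_of_nonneg hW0]
  calc _ ≤ s k ^ (-∑ i, αe i) * (C * (D * Real.sqrt n / 2 * (r / s k)) ^ (d + 1)) := by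
        gcongr
        refine hT.trans ?_
        gcongr
        exact hLρ y hy
    _ = _ := by rw [mul_pow]; ring

theorem Talpha_atom_pointwise_bound
    {n m : ℕ} (hm : 1 < m)
    (A : Fin m → Matrix (Fin n) (Fin n) ℝ) (hA : ∀ i, IsUnit (A i))
    (hAij : ∀ i j, i ≠ j → IsUnit (A i - A j))
    (α : ℝ) (hα0 : 0 ≤ α) (hαn : α < n)
    (αe : Fin m → ℝ) (hαe : ∀ i, 0 < αe i) (hsum : ∑ i, αe i = (n : ℝ) - α)
    (p : Rn n → ℝ) (hpmeas : Measurable p)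
    (hploc : LogHolderLocal p) (hpinf : LogHolderInfty p)
    (hpm : 0 < pMinus p) (hpbdd : BddAbove (Set.range p)) (hpp : pPlus p * α < n)
    (p₀ : ℝ) (hp₀ : max 1 (pPlus p) < p₀) (hp₀n : p₀ * α < n)
    (d : ℕ) (hd : dIndex p ≤ d)
    (κ : ℝ) (hκ : Real.sqrt n / 2 < κ) :
    ∃ C : ℝ, 0 < C ∧
      ∀ (a : Rn n → ℝ) (z : Rn n) (r : ℝ), 0 < r → IsPAtom p p₀ d a z r →
      ∀ (x : Rn n) (k : Fin m),
        (∀ i, κ * maxOpNorm A * r ≤ ‖x - mApp (A i) z‖) →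
        (∀ i, ‖x - mApp (A k) z‖ ≤ ‖x - mApp (A i) z‖) →
        MeasureTheory.Integrable (fun y => kern A αe x y * a y) ∧
        ENNReal.ofReal |Talpha A αe a x| ≤
          ENNReal.ofReal C * (varLpNorm p (cubeInd z r))⁻¹ *
            fracMax (α * n / (n + d + 1)) (cubeInd z r) (mApp (A k)⁻¹ x) ^
              (((n : ℝ) + d + 1) / n) := by
  have hn : 0 < n := by exact_mod_cast hα0.trans_lt hαn
  have hnR : (0 : ℝ) < n := by exact_mod_cast hn
  have hm0 : 0 < m := by omega
  have hD := maxOpNorm_pos hn hm0 hA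
  have hκ0 : 0 < κ := lt_of_le_of_lt (by positivity) hκ
  have hp₀1 : 1 ≤ p₀ := ((le_max_left _ _).trans_lt hp₀).le
  obtain ⟨C₁, hC₁, happrox⟩ := exists_kern_polynomial_approx hn hm0 hA (fun i => (hαe i).le) d hκ
  set D' := maxOpNorm fun i => (A i)⁻¹ with hD'
  have hD'0 : 0 ≤ D' := (norm_nonneg _).trans (opNorm_le_maxOpNorm (fun i => (A i)⁻¹) ⟨0, hm0⟩)
  set c : ℝ := (κ * maxOpNorm A)⁻¹ + 2 * D' with hc
  have hc0 : 0 < c := by positivity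
  set N : ℝ := n + d + 1 with hN
  have hN0 : 0 < N := by positivity
  refine ⟨C₁ * c ^ (N - α), by positivity, ?_⟩
  intro a z r hr ha x k hfar hk
  obtain ⟨P, hPdeg, hP⟩ := happrox z r hr x k hfar hk
  set ρ := ‖x - mApp (A k) z‖ with hρ
  have hρ0 : 0 < ρ := lt_of_lt_of_le (by positivity) (hfar k)
  set B : ℝ := C₁ * ρ ^ (-∑ i, αe i) * (r / ρ) ^ (d + 1) with hB
  have hB0 : 0 ≤ B := by positivity
  have haint := ha.integrable hr hp₀1 hpm
  set E : Rn n → ℝ := fun y => kern A αe x y - MvPolynomial.eval (fun i => y i) P with hE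
  have hPcont : Continuous fun y : Rn n => MvPolynomial.eval (fun i => y i) P := by
    simp only [MvPolynomial.eval_eq']
    fun_prop
  have hbound : ∀ y, ‖E y * a y‖ ≤ B * ‖a y‖ := by
    intro y
    by_cases hy : y ∈ cube z r
    · rw [norm_mul]
      gcongr
      exact hP y hy
    · simp [ha.support y hy]
  have hEint : Integrable fun y => E y * a y := by
    refine (haint.norm.const_mul B).mono' ?_ (Filter.Eventually.of_forall hbound)
    exact ((measurable_kern A αe x).sub hPcont.measurable).aestronglyMeasurable.mul
      ha.aestronglyMeasurable
  have hPint := integrable_mul_continuous_of_support hr.le haint ha.support hPcont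
  have hsplit : (fun y => kern A αe x y * a y) =
      fun y => E y * a y + a y * MvPolynomial.eval (fun i => y i) P := by
    ext y
    rw [hE]
    ring
  refine ⟨hsplit ▸ hEint.add hPint, ?_⟩
  have hT : Talpha A αe a x = ∫ y, E y * a y := by
    rw [Talpha, hsplit, integral_add hEint hPint,
      integral_mul_eval_eq_zero hr.le haint ha.support ha.moments hPdeg, add_zero]
  have hTle : ENNReal.ofReal |Talpha A αe a x| ≤ ENNReal.ofReal B * eLpNorm a 1 volume := by
    rw [hT, ← Real.norm_eq_abs, ofReal_norm, eLpNorm_one_eq_lintegral_enorm,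
      ← lintegral_const_mul' _ _ ENNReal.ofReal_ne_top]
    refine (enorm_integral_le_lintegral_enorm _).trans (lintegral_mono fun y => ?_)
    rw [← ofReal_norm, ← ofReal_norm, ← ENNReal.ofReal_mul hB0]
    exact ENNReal.ofReal_le_ofReal (hbound y)
  have hrc : r ≤ c * ρ := by
    calc r = (κ * maxOpNorm A)⁻¹ * (κ * maxOpNorm A * r) := by field_simp
      _ ≤ (κ * maxOpNorm A)⁻¹ * ρ := by gcongr; exact hfar k
      _ ≤ c * ρ := by gcongr; rw [hc]; linarith
  have hwc : 2 * ‖mApp (A k)⁻¹ x - z‖ ≤ c * ρ := by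
    have h1 : mApp (A k)⁻¹ x - z = mApp (A k)⁻¹ (x - mApp (A k) z) := by
      rw [mApp_sub, mApp_inv_mApp (hA k)]
    calc 2 * ‖mApp (A k)⁻¹ x - z‖ ≤ 2 * (D' * ρ) := by
          rw [h1]
          gcongr
          exact norm_mApp_le (fun i => (A i)⁻¹) k _
      _ = 2 * D' * ρ := by ring
      _ ≤ c * ρ := by
          gcongr
          rw [hc]
          exact le_add_of_nonneg_left (by positivity)
  have hM := ofReal_le_fracMax_cubeInd (α * n / N) hn z (mApp (A k)⁻¹ x) hr hrc hwc
  have hMpow := ENNReal.rpow_le_rpow hM (by positivity : (0 : ℝ) ≤ N / n)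
  have hreal : B * r ^ n =
      C₁ * c ^ (N - α) * ((c * ρ) ^ (α * n / N - n) * r ^ n) ^ (N / n) := by
    have h1 : ((c * ρ) ^ (α * n / N - n)) ^ (N / n) = c ^ (α - N) * ρ ^ (α - N) := by
      rw [← Real.rpow_mul (by positivity), ← Real.mul_rpow hc0.le hρ0.le]
      congr 1
      field_simp
    have h2 : ((r ^ n : ℝ)) ^ (N / n) = r ^ (d + 1) * r ^ n := by
      rw [← pow_add, ← Real.rpow_natCast, ← Real.rpow_mul hr.le, mul_div_cancel₀ _ hnR.ne',
        ← Real.rpow_natCast, hN]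
      congr 1
      push_cast
      ring
    have h3 : c ^ (N - α) * c ^ (α - N) = 1 := by
      rw [← Real.rpow_add hc0]
      simp
    have h4 : ρ ^ (α - N) = ρ ^ (-∑ i, αe i) * (ρ ^ (d + 1))⁻¹ := by
      rw [← Real.rpow_natCast, ← Real.rpow_neg hρ0.le, ← Real.rpow_add hρ0, hsum, hN]
      congr 1
      push_cast
      ring
    rw [Real.mul_rpow (by positivity) (by positivity), h1, h2, hB, div_pow, h4]
    calc _ = C₁ * 1 * (ρ ^ (-∑ i, αe i) * (ρ ^ (d + 1))⁻¹) * (r ^ (d + 1) * r ^ n) := by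
          rw [div_eq_mul_inv]; ring
      _ = _ := by rw [← h3]; ring
  calc ENNReal.ofReal |Talpha A αe a x| ≤ _ := hTle
    _ ≤ ENNReal.ofReal B * (ENNReal.ofReal (r ^ n) * (varLpNorm p (cubeInd z r))⁻¹) := by
        gcongr
        exact ha.eLpNorm_one_le hr hp₀1
    _ = ENNReal.ofReal (B * r ^ n) * (varLpNorm p (cubeInd z r))⁻¹ := by
        rw [ENNReal.ofReal_mul hB0, mul_assoc]
    _ = ENNReal.ofReal (C₁ * c ^ (N - α)) * (varLpNorm p (cubeInd z r))⁻¹ *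
          ENNReal.ofReal ((c * ρ) ^ (α * n / N - n) * r ^ n) ^ (N / n) := by
        rw [hreal, ENNReal.ofReal_mul (by positivity),
          ENNReal.ofReal_rpow_of_nonneg (by positivity) (by positivity)]
        ring
    _ ≤ _ := by gcongr
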